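/- In the unit-weight set system constructed from a 3-dimensional matching instance (A, B, C, F) with |A| = 2q and |B| = |C| = q, the family F admits a 3-dimensional matching of cardinality q if and only if the minimum cardinality of a feasible solution equals q. (Lemma 7 of the paper, establishing the reduction used to prove NP-hardness of MTRS-minNum.) -/

import Mathlib

open Finset

/-- Two matches are disjoint: distinct drivers and disjoint rider sets. -/
def MDisj {V : Type*} (e f : V × Finset V) : Prop :=
  e.1 ≠ f.1 ∧ Disjoint e.2 f.2

/-- A feasible solution given as a set of matches. -/
def FeasSet {V : Type*} [DecidableEq V] (E : Finset (V × Finset V)) (R : Finset V)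
    (M : Finset (V × Finset V)) : Prop :=
  M ⊆ E ∧ (∀ e ∈ M, ∀ f ∈ M, e ≠ f → MDisj e f) ∧ M.biUnion Prod.snd = R

/-- A 3-dimensional matching: a set of triples no two of which share a first, second, or
third component. -/
def Is3DMatching {V : Type*} (M : Finset (V × V × V)) : Prop :=
  ∀ f ∈ M, ∀ g ∈ M, f ≠ g → f.1 ≠ g.1 ∧ f.2.1 ≠ g.2.1 ∧ f.2.2 ≠ g.2.2

/-- The set system constructed from a 3DM instance `(A,B,C,F)`: for each triple
`(a,b,c) ∈ F` the matches `(a,{b,c})`, `(a,{b})`, `(a,{c})`, and additionally the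
matches `(a,{b})` and `(a,{c})` for every pair `a ∈ A, b ∈ B` and `a ∈ A, c ∈ C`. -/
def E3DM {V : Type*} [DecidableEq V] (A B C : Finset V) (F : Finset (V × V × V)) :
    Finset (V × Finset V) :=
  F.image (fun f => (f.1, ({f.2.1, f.2.2} : Finset V))) ∪
  (A ×ˢ (B ∪ C)).image (fun p => (p.1, ({p.2} : Finset V)))

lemma card_snd_le_two_of_mem_E3DM {V : Type*} [DecidableEq V] {A B C : Finset V}
    {F : Finset (V × V × V)} {e : V × Finset V} (he : e ∈ E3DM A B C F) : e.2.card ≤ 2 := by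
  simp only [E3DM, mem_union, mem_image] at he
  obtain ⟨f, -, rfl⟩ | ⟨p, -, rfl⟩ := he
  · exact card_le_two
  · simp

lemma exists_triple_of_mem_E3DM {V : Type*} [DecidableEq V] {A B C : Finset V}
    {F : Finset (V × V × V)} {e : V × Finset V} (he : e ∈ E3DM A B C F) (h2 : 2 ≤ e.2.card) :
    ∃ f ∈ F, (f.1, ({f.2.1, f.2.2} : Finset V)) = e := by
  simp only [E3DM, mem_union, mem_image] at he
  obtain h | ⟨p, -, rfl⟩ := he
  · exact h
  · simp at h2

lemma FeasSet.card_le_sum {V : Type*} [DecidableEq V] {E M : Finset (V × Finset V)}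
    {R : Finset V} (h : FeasSet E R M) : R.card ≤ ∑ e ∈ M, e.2.card :=
  h.2.2 ▸ card_biUnion_le

lemma FeasSet.card_le_two_mul {V : Type*} [DecidableEq V] {A B C R : Finset V}
    {F : Finset (V × V × V)} {M : Finset (V × Finset V)} (h : FeasSet (E3DM A B C F) R M) :
    R.card ≤ 2 * M.card := by
  have h2 := sum_le_card_nsmul M (fun e => e.2.card) 2
    fun e he => card_snd_le_two_of_mem_E3DM (h.1 he)
  have := h.card_le_sum
  simp only [smul_eq_mul] at h2
  lia

lemma FeasSet.two_le_card_snd {V : Type*} [DecidableEq V] {A B C R : Finset V}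
    {F : Finset (V × V × V)} {M : Finset (V × Finset V)} (h : FeasSet (E3DM A B C F) R M)
    (hR : R.card = 2 * M.card) {e : V × Finset V} (he : e ∈ M) : 2 ≤ e.2.card := by
  by_contra! hlt
  have hsum := sum_lt_sum (f := fun e : V × Finset V => e.2.card) (g := fun _ => 2)
    (fun e he => card_snd_le_two_of_mem_E3DM (h.1 he)) ⟨e, he, hlt⟩
  have := h.card_le_sum
  simp only [sum_const, smul_eq_mul] at hsum
  lia

lemma image_eq_of_injOn_of_card_eq {α β : Type*} [DecidableEq β] {s : Finset α} {t : Finset β}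
    {f : α → β} (hmaps : ∀ x ∈ s, f x ∈ t) (hinj : Set.InjOn f s) (hcard : s.card = t.card) :
    s.image f = t :=
  eq_of_subset_of_card_le (image_subset_iff.2 hmaps) (by rw [card_image_of_injOn hinj, hcard])

/-- A 3-dimensional matching of size `|B| = |C|` gives a feasible solution of the same size. -/
lemma Is3DMatching.exists_feasSet {V : Type*} [DecidableEq V] {A B C : Finset V}
    {F M : Finset (V × V × V)} (hM : Is3DMatching M) (hMF : M ⊆ F) (hBC : Disjoint B C)
    (hF : ∀ f ∈ F, f.1 ∈ A ∧ f.2.1 ∈ B ∧ f.2.2 ∈ C) (hB : M.card = B.card)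
    (hC : M.card = C.card) :
    ∃ N : Finset (V × Finset V), FeasSet (E3DM A B C F) (B ∪ C) N ∧ N.card = M.card := by
  refine ⟨M.image fun f => (f.1, ({f.2.1, f.2.2} : Finset V)), ⟨?_, ?_, ?_⟩, ?_⟩
  · exact (image_subset_image hMF).trans subset_union_left
  · simp only [forall_mem_image]
    intro f hf g hg hne
    have hfg : f ≠ g := by rintro rfl; exact hne rfl
    obtain ⟨h1, h2, h3⟩ := hM f hf g hg hfg
    obtain ⟨-, hfB, hfC⟩ := hF f (hMF hf)
    obtain ⟨-, hgB, hgC⟩ := hF g (hMF hg)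
    have h4 := disjoint_iff_ne.1 hBC _ hfB _ hgC
    have h5 := (disjoint_iff_ne.1 hBC _ hgB _ hfC).symm
    refine ⟨h1, ?_⟩
    simp [h2.symm, h3.symm, h4.symm, h5.symm]
  · have hB' : M.image (fun f => f.2.1) = B :=
      image_eq_of_injOn_of_card_eq (fun f hf => (hF f (hMF hf)).2.1)
        (fun f hf g hg h => by_contra fun hne => (hM f hf g hg hne).2.1 h) hB
    have hC' : M.image (fun f => f.2.2) = C :=
      image_eq_of_injOn_of_card_eq (fun f hf => (hF f (hMF hf)).2.2)
        (fun f hf g hg h => by_contra fun hne => (hM f hf g hg hne).2.2 h) hC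
    rw [← hB', ← hC']
    ext x
    simp only [mem_biUnion, mem_image, mem_union, exists_exists_and_eq_and, mem_insert,
      mem_singleton]
    grind
  · exact card_image_of_injOn fun f hf g hg h =>
      by_contra fun hne => (hM f hf g hg hne).1 (Prod.ext_iff.1 h).1

/-- A feasible solution whose size is half the number of riders gives a 3-dimensional matching
of the same size. -/
lemma FeasSet.exists_is3DMatching {V : Type*} [DecidableEq V] {A B C R : Finset V}
    {F : Finset (V × V × V)} {N : Finset (V × Finset V)} (h : FeasSet (E3DM A B C F) R N)
    (hR : R.card = 2 * N.card) : ∃ M ⊆ F, Is3DMatching M ∧ M.card = N.card := by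
  have hex (e : V × Finset V) :
      ∃ f : V × V × V, e ∈ N → f ∈ F ∧ (f.1, ({f.2.1, f.2.2} : Finset V)) = e := by
    by_cases he : e ∈ N
    · obtain ⟨f, hf⟩ := exists_triple_of_mem_E3DM (h.1 he) (h.two_le_card_snd hR he)
      exact ⟨f, fun _ => hf⟩
    · exact ⟨(e.1, e.1, e.1), fun h => absurd h he⟩
  choose φ hφ' using hex
  have hφF e (he : e ∈ N) := (hφ' e he).1
  have hφ e (he : e ∈ N) := (hφ' e he).2
  refine ⟨N.image φ, image_subset_iff.2 hφF, ?_, ?_⟩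
  · simp only [Is3DMatching, forall_mem_image]
    intro e he e' he' hne
    have hee' : e ≠ e' := by rintro rfl; exact hne rfl
    obtain ⟨h1, h2⟩ := h.2.1 e he e' he' hee'
    rw [← hφ e he, ← hφ e' he'] at h1 h2
    exact ⟨h1, disjoint_iff_ne.1 h2 _ (by simp) _ (by simp),
      disjoint_iff_ne.1 h2 _ (by simp) _ (by simp)⟩
  · refine card_image_of_injOn fun e he e' he' hee' => ?_
    rw [← hφ e he, ← hφ e' he', hee']

/-- Lemma 7: the 3DM instance `(A,B,C,F)` with `|A| = 2q`, `|B| = |C| = q` has a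
3-dimensional matching of cardinality `q` iff the minimum cardinality of a feasible
solution of the constructed (unit-weight) set system is `q`. -/
theorem threeDM_iff_minNum {V : Type*} [DecidableEq V] (q : ℕ) (hq : 1 ≤ q)
    (A B C : Finset V) (hAB : Disjoint A B) (hAC : Disjoint A C) (hBC : Disjoint B C)
    (hA : A.card = 2 * q) (hB : B.card = q) (hC : C.card = q)
    (F : Finset (V × V × V)) (hF : ∀ f ∈ F, f.1 ∈ A ∧ f.2.1 ∈ B ∧ f.2.2 ∈ C) :
    (∃ M ⊆ F, Is3DMatching M ∧ M.card = q) ↔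
    IsLeast {n : ℕ | ∃ M : Finset (V × Finset V),
      FeasSet (E3DM A B C F) (B ∪ C) M ∧ M.card = n} q := by
  have hcard : (B ∪ C).card = 2 * q := by
    rw [card_union_of_disjoint hBC, hB, hC, two_mul]
  constructor
  · rintro ⟨M, hMF, hM, rfl⟩
    refine ⟨hM.exists_feasSet hMF hBC hF hB.symm hC.symm, ?_⟩
    rintro n ⟨N, hN, rfl⟩
    have := hN.card_le_two_mul
    lia
  · rintro ⟨⟨N, hN, rfl⟩, -⟩
    exact hN.exists_is3DMatching hcard
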